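/- Let q be an odd prime power, δ a generator of 𝔽_{q²}ˣ, and M ⊆ ℤ/(q²−1)ℤ a union of cosets of (q−1)ℤ/(q²−1)ℤ. With x_{i,j}, y_{i,j}, k(i,j), l(i,j) as determined by δ^{x_{i,j}} = 1 + δ^{j−i}, y_{i,j} = x_{i,j} + i − j, l(i,j) = i − x_{i,j}(q−1), k(i,j) = j − y_{i,j}(q−1) for i ≢ j (mod q−1), let Γ_{M,δ} be the group presented by generators a_i for i ∈ M, subject to a_{i+(q²−1)/2}·a_i = 1 for all i ∈ M, and a_i·a_j = a_{k(i,j)}·a_{l(i,j)} for all i, j ∈ M with i ≢ j (mod q−1). Then, with S₀ = {δ^{−i(q+1)} : i ∈ M} ⊆ 𝔽_qˣ, the assignment a_i ↦ [1 + δ^i·j] extends to a group isomorphism Γ_{M,δ} ≅ Γ_S. -/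

import Mathlib

open Polynomial Quaternion

noncomputable section

/-- The multiplicative set of `𝔽_q[t]` generated by `t` and `t - τ` for `τ ∈ S₀`. -/
def sden (F : Type) [Field F] (S₀ : Set F) : Submonoid F[X] :=
  Submonoid.closure ({X} ∪ (fun τ : F => X - C τ) '' S₀)

/-- The ring `o_S`, the localization of `𝔽_q[t]` inverting `t` and `t - τ` for `τ ∈ S₀`. -/
abbrev OS (F : Type) [Field F] (S₀ : Set F) := Localization (sden F S₀)

/-- The quaternion algebra `ℍ[o_S, c, t]` with `i² = c`, `j² = t`, `ij = -ji = k`. -/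
abbrev QAS (F : Type) [Field F] (S₀ : Set F) (c : F) : Type :=
  ℍ[OS F S₀, algebraMap F[X] (OS F S₀) (C c), algebraMap F[X] (OS F S₀) X]

/-- The central subgroup of scalar units. -/
def scalarUnits (R A : Type*) [CommRing R] [Ring A] [Algebra R A] : Subgroup Aˣ :=
  (Units.map (algebraMap R A).toMonoidHom).range

instance scalarUnits_normal (R A : Type*) [CommRing R] [Ring A] [Algebra R A] :
    (scalarUnits R A).Normal := by
  constructor
  intro n hn g
  obtain ⟨r, rfl⟩ := hn
  refine ⟨r, ?_⟩
  ext
  simp only [Units.val_mul, Units.coe_map, RingHom.toMonoidHom_eq_coe, MonoidHom.coe_coe]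
  rw [← Algebra.commutes (r : R) ((g : Aˣ) : A), mul_assoc, Units.mul_inv, mul_one]

/-- The group `Λ_S = ℍ[o_S, c, t]ˣ/o_Sˣ`. -/
abbrev LambdaS (F : Type) [Field F] (S₀ : Set F) (c : F) : Type :=
  (QAS F S₀ c)ˣ ⧸ scalarUnits (OS F S₀) (QAS F S₀ c)

/-- The class `[w]` of a unit `w`. -/
abbrev clsS (F : Type) [Field F] (S₀ : Set F) (c : F) : (QAS F S₀ c)ˣ →* LambdaS F S₀ c :=
  QuotientGroup.mk' _

/-- The canonical map `F → o_S`. -/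
def toOS (F : Type) [Field F] (S₀ : Set F) : F →+* OS F S₀ :=
  (algebraMap F[X] (OS F S₀)).comp (C : F →+* F[X])

/-- The quaternion `1 + α·j = 1 + x·j + y·k` for `α = x + y·√c ∈ 𝔽_{q²}`. -/
def oneAddJ (F : Type) [Field F] (S₀ : Set F) (c : F) (x y : F) : QAS F S₀ c :=
  ⟨1, 0, toOS F S₀ x, toOS F S₀ y⟩

/-- `α = x + y·√c` in `𝔽_{q²} = F(√c)`. -/
def hasCoord (F : Type) [Field F] (E : Type) [Field E] [Algebra F E] (s : E)
    (α : E) (x y : F) : Prop :=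
  α = algebraMap F E x + algebraMap F E y * s

/-- The set `PA_τ = {[1 + α·j] : α ∈ 𝔽_{q²}, N(α) = α^{q+1} = τ⁻¹} ⊆ Λ_S`. -/
def PASet (F : Type) [Field F] [Fintype F] (E : Type) [Field E] [Algebra F E] (s : E)
    (S₀ : Set F) (c : F) (τ : F) : Set (LambdaS F S₀ c) :=
  {z | ∃ (α : E) (x y : F) (w : (QAS F S₀ c)ˣ),
    hasCoord F E s α x y ∧
    α ^ (Fintype.card F + 1) = algebraMap F E τ⁻¹ ∧
    (w : QAS F S₀ c) = oneAddJ F S₀ c x y ∧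
    z = clsS F S₀ c w}

/-- The group `Γ_S`, generated by all `PA_τ`, `τ ∈ S₀`. -/
def GammaS (F : Type) [Field F] [Fintype F] (E : Type) [Field E] [Algebra F E] (s : E)
    (S₀ : Set F) (c : F) : Subgroup (LambdaS F S₀ c) :=
  Subgroup.closure (⋃ τ ∈ S₀, PASet F E s S₀ c τ)


/-- The set `S₀ = {δ^{-i(q+1)} : i ∈ M} ⊆ 𝔽_qˣ` (viewed inside `𝔽_{q²}`). -/
def SofM (F : Type) [Field F] [Fintype F] (E : Type) [Field E] [Algebra F E]
    (δ : E) (n : ℕ) (M : Set (ZMod n)) : Set F :=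
  {τ : F | ∃ i : {x : ZMod n // x ∈ M},
    algebraMap F E τ = ((δ ^ (Fintype.card F + 1))⁻¹) ^ (i : ZMod n).val}

/-- The relations of `Γ_{M,δ}`: `a_{i+(q²-1)/2}·a_i = 1` for `i ∈ M`, and
`a_i·a_j = a_{k(i,j)}·a_{l(i,j)}` for `i, j ∈ M` with `i ≢ j (mod q-1)`. -/
def relsGM (q n : ℕ) (M : Set (ZMod n)) (kf lf : ZMod n → ZMod n → ZMod n) :
    Set (FreeGroup {x : ZMod n // x ∈ M}) :=
  {r | ∃ i j : {x : ZMod n // x ∈ M}, (j : ZMod n) = (i : ZMod n) + ((n / 2 : ℕ) : ZMod n) ∧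
        r = FreeGroup.of j * FreeGroup.of i} ∪
  {r | ∃ i j k l : {x : ZMod n // x ∈ M},
        (i : ZMod n) - (j : ZMod n) ∉ AddSubgroup.zmultiples ((q : ZMod n) - 1) ∧
        (k : ZMod n) = kf i j ∧ (l : ZMod n) = lf i j ∧
        r = FreeGroup.of i * FreeGroup.of j * (FreeGroup.of k * FreeGroup.of l)⁻¹}

theorem exists_swap_past_block {ι G N : Type*} [Group G] (g : ι → G) (ν : ι → N)
    (hswap : ∀ i j, ν i ≠ ν j → ∃ k l, g i * g j = g k * g l ∧ ν k = ν j ∧ ν l = ν i)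
    (m : N) (a : ι) (ha : ν a ≠ m) (L : List ι) (hL : ∀ b ∈ L, ν b = m) :
    ∃ (L' : List ι) (a' : ι), L'.length = L.length ∧ (∀ b ∈ L', ν b = m) ∧ ν a' ≠ m ∧
      g a * (L.map g).prod = (L'.map g).prod * g a' := by
  induction L generalizing a with
  | nil => exact ⟨[], a, rfl, by simp, ha, by simp⟩
  | cons b L ih =>
    have hb : ν b = m := hL b (by simp)
    obtain ⟨k, l, h, hk, hl⟩ := hswap a b (by rwa [hb])
    obtain ⟨L', a', hlen, hL', ha', hprod⟩ := ih l (by rwa [hl]) fun x hx => hL x (by simp [hx])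
    refine ⟨k :: L', a', by simp [hlen], ?_, ha', ?_⟩
    · simpa [hk, hb] using hL'
    · simp only [List.map_cons, List.prod_cons]
      rw [← mul_assoc, h, mul_assoc, hprod, mul_assoc]

/-- Every product of letters can be rewritten, without changing its length, so that the letters of
type `m` come first. -/
theorem exists_sort {ι G N : Type*} [Group G] (g : ι → G) (ν : ι → N)
    (hswap : ∀ i j, ν i ≠ ν j → ∃ k l, g i * g j = g k * g l ∧ ν k = ν j ∧ ν l = ν i)
    (m : N) (L : List ι) :
    ∃ L₁ L₂ : List ι, L₁.length + L₂.length = L.length ∧ (∀ b ∈ L₁, ν b = m) ∧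
      (∀ b ∈ L₂, ν b ≠ m) ∧ (L.map g).prod = (L₁.map g).prod * (L₂.map g).prod := by
  induction L with
  | nil => exact ⟨[], [], by simp⟩
  | cons a L ih =>
    obtain ⟨L₁, L₂, hlen, h₁, h₂, hprod⟩ := ih
    by_cases ha : ν a = m
    · refine ⟨a :: L₁, L₂, by simp [← hlen]; omega, by simpa [ha] using h₁, h₂, ?_⟩
      simp [hprod, mul_assoc]
    · obtain ⟨L', a', hlen', hL', ha', hp⟩ := exists_swap_past_block g ν hswap m a ha L₁ h₁
      refine ⟨L', a' :: L₂, by simp [← hlen, hlen']; omega, hL', by simpa [ha'] using h₂, ?_⟩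
      simp only [List.map_cons, List.prod_cons]
      rw [hprod, ← mul_assoc, hp, mul_assoc]

theorem exists_list_prod {ι G : Type*} [Group G] (g : ι → G) (op : ι → ι)
    (hop : ∀ i, g (op i) * g i = 1) (hgen : Subgroup.closure (Set.range g) = ⊤) (x : G) :
    ∃ L : List ι, x = (L.map g).prod := by
  have hx : x ∈ Subgroup.closure (Set.range g) := by simp [hgen]
  induction hx using Subgroup.closure_induction_left with
  | one => exact ⟨[], by simp⟩
  | mul_left x hx y _ ih =>
    obtain ⟨i, rfl⟩ := hx
    obtain ⟨L, rfl⟩ := ih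
    exact ⟨i :: L, by simp⟩
  | inv_mul_cancel x hx y _ ih =>
    obtain ⟨i, rfl⟩ := hx
    obtain ⟨L, rfl⟩ := ih
    exact ⟨op i :: L, by simp [eq_inv_of_mul_eq_one_left (hop i)]⟩

/-- In a group generated by a family `g` closed under inverses, in which two letters of different
type can be swapped, every nontrivial element is a product of a nonempty block of letters of one
type without cancellations, followed by letters of other types. -/
theorem exists_reduced_block {ι G N : Type*} [Group G] (g : ι → G) (ν : ι → N) (op : ι → ι)
    (hop : ∀ i, g (op i) * g i = 1) (hgen : Subgroup.closure (Set.range g) = ⊤)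
    (hswap : ∀ i j, ν i ≠ ν j → ∃ k l, g i * g j = g k * g l ∧ ν k = ν j ∧ ν l = ν i)
    (x : G) (hx : x ≠ 1) :
    ∃ (a : ι) (L₁ L₂ : List ι), x = ((a :: L₁).map g).prod * (L₂.map g).prod ∧
      (∀ b ∈ L₁, ν b = ν a) ∧ (∀ b ∈ L₂, ν b ≠ ν a) ∧
      (a :: L₁).IsChain fun b c => g b * g c ≠ 1 := by
  classical
  have hex : ∃ m, ∃ L : List ι, L.length = m ∧ x = (L.map g).prod := by
    obtain ⟨L, hL⟩ := exists_list_prod g op hop hgen x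
    exact ⟨_, L, rfl, hL⟩
  obtain ⟨L, hlen, hL⟩ := Nat.find_spec hex
  cases L with
  | nil => exact absurd (by simpa using hL) hx
  | cons a L =>
    obtain ⟨L₁, L₂, hlen', h₁, h₂, hp⟩ := exists_sort g ν hswap (ν a) L
    have hx' : x = ((a :: L₁).map g).prod * (L₂.map g).prod := by
      rw [hL]; simp [hp, mul_assoc]
    refine ⟨a, L₁, L₂, hx', h₁, h₂, ?_⟩
    rw [List.isChain_iff_forall_rel_of_append_cons_cons]
    intro b c l₁ l₂ heq hbc
    refine Nat.find_min hex (m := (l₁ ++ l₂ ++ L₂).length) ?_ ⟨_, rfl, ?_⟩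
    · have := congrArg List.length heq
      rw [← hlen]
      simp at this ⊢
      omega
    · rw [hx', heq]
      simp only [List.map_append, List.map_cons, List.prod_append, List.prod_cons]
      rw [← mul_assoc (g b), hbc, one_mul]

/-- The ring homomorphism of quaternion algebras induced by a homomorphism of the base rings. -/
def quatMap {R S : Type*} [CommRing R] [CommRing S] (f : R →+* S) {a b : R} {a' b' : S}
    (ha : f a = a') (hb : f b = b') : ℍ[R, a, b] →+* ℍ[S, a', b'] where
  toFun x := ⟨f x.re, f x.imI, f x.imJ, f x.imK⟩
  map_one' := by ext <;> simp
  map_zero' := by ext <;> simp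
  map_add' x y := by ext <;> simp
  map_mul' x y := by subst ha hb; ext <;> simp

/-- The reduced norm of the quaternion algebra `ℍ[R, a, b]`. -/
def quatNorm {R : Type*} [CommRing R] {a b : R} : ℍ[R, a, b] →* R where
  toFun u := u.re ^ 2 - a * u.imI ^ 2 - b * u.imJ ^ 2 + a * b * u.imK ^ 2
  map_one' := by simp
  map_mul' u v := by simp; ring

theorem mul_conj_eq_quatNorm {R : Type*} [CommRing R] {a b : R} (u : ℍ[R, a, b]) :
    u * ⟨u.re, -u.imI, -u.imJ, -u.imK⟩ = ⟨quatNorm u, 0, 0, 0⟩ := by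
  ext <;> simp [quatNorm] <;> ring

theorem sq_sub_mul_sq_eq_zero {F : Type*} [Field F] {c : F} (hc : ¬IsSquare c) {x y : F}
    (h : x ^ 2 - c * y ^ 2 = 0) : x = 0 ∧ y = 0 := by
  have hy : y = 0 := by
    by_contra hy
    exact hc ⟨x / y, by field_simp; linear_combination -h⟩
  subst hy
  simpa using h

theorem prod_block_eq {F ι : Type*} [Field F] {c τ : F} (hc : ¬IsSquare c) (ax ay : ι → F)
    (a : ι) (L : List ι) (ha : τ * (ax a ^ 2 - c * ay a ^ 2) = 1)
    (hL : ∀ b ∈ L, τ * (ax b ^ 2 - c * ay b ^ 2) = 1)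
    (hch : (a :: L).IsChain fun b c => ¬(ax b = -ax c ∧ ay b = -ay c)) :
    ∃ p r : F, p ^ 2 - c * r ^ 2 ≠ 0 ∧
      ((a :: L).map fun i => (⟨1, 0, ax i, ay i⟩ : ℍ[F, c, τ])).prod =
        ⟨1, 0, ax a, ay a⟩ * ⟨p, r, 0, 0⟩ := by
  induction L generalizing a with
  | nil => exact ⟨1, 0, by simp, by ext <;> simp⟩
  | cons b L ih =>
    rw [List.isChain_cons_cons] at hch
    have hb := hL b (by simp)
    obtain ⟨p, r, hpr, hp⟩ := ih b hb (fun x hx => hL x (by simp [hx])) hch.2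
    set u := 1 + τ * (ax a * ax b - c * ay a * ay b) with hu
    set v := τ * (ay a * ax b - ax a * ay b) with hv
    have huv : u ^ 2 - c * v ^ 2 ≠ 0 := by
      intro h0
      obtain ⟨h1, h2⟩ := sq_sub_mul_sq_eq_zero hc h0
      refine hch.1 ⟨?_, ?_⟩
      · linear_combination ax b * h1 - ax a * hb + c * ay b * h2
      · linear_combination ay b * h1 - ay a * hb + ax b * h2
    refine ⟨p * u + c * r * v, p * v + r * u, ?_, ?_⟩
    · rw [show (p * u + c * r * v) ^ 2 - c * (p * v + r * u) ^ 2 =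
        (p ^ 2 - c * r ^ 2) * (u ^ 2 - c * v ^ 2) by ring]
      exact mul_ne_zero hpr huv
    · rw [List.map_cons, List.prod_cons, hp]
      ext
      · simp [hu, hv]; ring
      · simp [hu, hv]; ring
      · simp [hu, hv]
        linear_combination -(p * ax b - c * r * ay b) * ha
      · simp [hu, hv]
        linear_combination -(p * ay b - r * ax b) * ha

/-- A reduced block of linear quaternions of one norm times linear quaternions of other norms is
never a scalar. -/
theorem not_scalar {F ι : Type*} [Field F] {c : F} (hc : ¬IsSquare c) (ax ay : ι → F)
    (a : ι) (L₁ L₂ : List ι) (ha : ax a ^ 2 - c * ay a ^ 2 ≠ 0)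
    (hL₁ : ∀ b ∈ L₁, ax b ^ 2 - c * ay b ^ 2 = ax a ^ 2 - c * ay a ^ 2)
    (hL₂ : ∀ b ∈ L₂, ax b ^ 2 - c * ay b ^ 2 ≠ ax a ^ 2 - c * ay a ^ 2)
    (hch : (a :: L₁).IsChain fun b c => ¬(ax b = -ax c ∧ ay b = -ay c)) (f : F[X])
    (hf : (((a :: L₁) ++ L₂).map
      fun i => (⟨1, 0, C (ax i), C (ay i)⟩ : ℍ[F[X], C c, X])).prod = ⟨f, 0, 0, 0⟩) : False := by
  set τ := (ax a ^ 2 - c * ay a ^ 2)⁻¹ with hτ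
  have hτa : τ * (ax a ^ 2 - c * ay a ^ 2) = 1 := inv_mul_cancel₀ ha
  have hmap := congrArg (quatMap (evalRingHom τ) (a' := c) (b' := τ) (by simp) (by simp)) hf
  rw [map_list_prod, List.map_map] at hmap
  have hcomp : (quatMap (evalRingHom τ) (a' := c) (b' := τ) (by simp) (by simp)) ∘
      (fun i => (⟨1, 0, C (ax i), C (ay i)⟩ : ℍ[F[X], C c, X])) =
      fun i => (⟨1, 0, ax i, ay i⟩ : ℍ[F, c, τ]) := by
    funext i; ext <;> simp [quatMap]
  rw [hcomp, List.map_append, List.prod_append] at hmap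
  have hr : quatMap (evalRingHom τ) (a := C c) (b := X) (a' := c) (b' := τ) (by simp) (by simp)
      ⟨f, 0, 0, 0⟩ = ⟨f.eval τ, 0, 0, 0⟩ := by ext <;> simp [quatMap]
  rw [hr] at hmap
  obtain ⟨p, r, hpr, hblock⟩ := prod_block_eq (τ := τ) hc ax ay a L₁ hτa
    (fun b hb => by rw [hL₁ b hb, hτa]) hch
  set P := (L₂.map fun i => (⟨1, 0, ax i, ay i⟩ : ℍ[F, c, τ])).prod with hP
  have hPn : quatNorm P ≠ 0 := by
    rw [hP, map_list_prod]
    refine List.prod_ne_zero fun h0 => ?_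
    simp only [List.map_map, List.mem_map] at h0
    obtain ⟨b, hb, h0⟩ := h0
    refine hL₂ b hb (mul_left_cancel₀ (left_ne_zero_of_mul_eq_one hτa) ?_)
    rw [hτa]
    simp [quatNorm] at h0
    linear_combination -h0
  rw [hblock] at hmap
  have h0 : f.eval τ = 0 := by
    have h1 := congrArg quatNorm hmap
    have h2 : quatNorm (⟨1, 0, ax a, ay a⟩ : ℍ[F, c, τ]) = 0 := by
      simp [quatNorm]; linear_combination -hτa
    rw [map_mul, map_mul, h2] at h1
    simpa [quatNorm] using h1.symm
  have h3 := congrArg (· * (⟨P.re, -P.imI, -P.imJ, -P.imK⟩ : ℍ[F, c, τ])) hmap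
  simp only [mul_assoc, mul_conj_eq_quatNorm, h0] at h3
  have h4 := congrArg QuaternionAlgebra.re h3
  have h5 := congrArg QuaternionAlgebra.imI h3
  simp [hPn] at h4 h5
  exact hpr (by simp [h4, h5])

theorem pow_card_add {F E : Type*} [Field F] [Fintype F] [Field E] [Algebra F E] (α β : E) :
    (α + β) ^ Fintype.card F = α ^ Fintype.card F + β ^ Fintype.card F :=
  map_add (FiniteField.frobeniusAlgHom F E) α β

section QuadraticExtension

variable {F E : Type} [Field F] [Field E] [Algebra F E] {c : F} {s : E}

theorem hasCoord_inj (hc : ¬IsSquare c) (hs : s ^ 2 = algebraMap F E c) {α : E} {x y x' y' : F}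
    (h : hasCoord F E s α x y) (h' : hasCoord F E s α x' y') : x = x' ∧ y = y' := by
  unfold hasCoord at h h'
  have key : algebraMap F E ((x - x') ^ 2 - c * (y - y') ^ 2) = 0 := by
    simp only [map_sub, map_pow, map_mul, ← hs]
    linear_combination (h' - h) * (algebraMap F E x - algebraMap F E x' -
      s * (algebraMap F E y - algebraMap F E y'))
  have := sq_sub_mul_sq_eq_zero hc ((map_eq_zero _).1 key)
  exact ⟨sub_eq_zero.1 this.1, sub_eq_zero.1 this.2⟩

theorem card_eq_sq [Fintype F] (hc : ¬IsSquare c) (hs : s ^ 2 = algebraMap F E c)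
    (hspan : ∀ α : E, ∃ x y : F, hasCoord F E s α x y) : Nat.card E = Fintype.card F ^ 2 := by
  have hbij : Function.Bijective fun p : F × F => algebraMap F E p.1 + algebraMap F E p.2 * s := by
    refine ⟨fun p p' h => ?_, fun α => ?_⟩
    · exact Prod.ext_iff.2 (hasCoord_inj hc hs (α := algebraMap F E p.1 + algebraMap F E p.2 * s)
        rfl h)
    · obtain ⟨x, y, h⟩ := hspan α
      exact ⟨(x, y), h.symm⟩
  rw [← Nat.card_congr (Equiv.ofBijective _ hbij), Nat.card_prod, Nat.card_eq_fintype_card, sq]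

theorem pow_card_of_hasCoord [Fintype F] (hq : Odd (Fintype.card F)) (hc : ¬IsSquare c)
    (hs : s ^ 2 = algebraMap F E c) {α : E} {x y : F} (h : hasCoord F E s α x y) :
    α ^ Fintype.card F = algebraMap F E x - algebraMap F E y * s := by
  have hF : ringChar F ≠ 2 := fun h2 => by
    have := FiniteField.even_card_iff_char_two.1 h2
    obtain ⟨k, hk⟩ := hq
    omega
  have hc0 : c ≠ 0 := by
    rintro rfl
    exact hc ⟨0, by simp⟩
  have hcm : c ^ (Fintype.card F / 2) = -1 :=
    (FiniteField.pow_dichotomy hF hc0).resolve_left fun h1 =>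
      hc ((FiniteField.isSquare_iff hF hc0).2 h1)
  have hsq : s ^ Fintype.card F = -s := by
    have : Fintype.card F = 2 * (Fintype.card F / 2) + 1 := by
      obtain ⟨k, hk⟩ := hq
      omega
    rw [this, pow_succ, pow_mul, hs, ← map_pow, hcm]
    simp
  rw [h, pow_card_add, mul_pow, hsq, ← map_pow, ← map_pow, FiniteField.pow_card,
    FiniteField.pow_card]
  ring

theorem pow_card_succ_of_hasCoord [Fintype F] (hq : Odd (Fintype.card F)) (hc : ¬IsSquare c)
    (hs : s ^ 2 = algebraMap F E c) {α : E} {x y : F} (h : hasCoord F E s α x y) :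
    α ^ (Fintype.card F + 1) = algebraMap F E (x ^ 2 - c * y ^ 2) := by
  rw [pow_succ, pow_card_of_hasCoord hq hc hs h, h]
  simp only [map_sub, map_pow, map_mul, ← hs]
  ring

/-- Coordinates of the identities `α + β = κ + μ` and `α β^q = κ μ^q`. -/
theorem coord_relations [Fintype F] (hq : Odd (Fintype.card F)) (hc : ¬IsSquare c)
    (hs : s ^ 2 = algebraMap F E c) {α β κ μ : E} {a a' b b' k k' m m' : F}
    (hα : hasCoord F E s α a a') (hβ : hasCoord F E s β b b')
    (hκ : hasCoord F E s κ k k') (hμ : hasCoord F E s μ m m')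
    (hadd : κ + μ = α + β) (hmul : κ * μ ^ Fintype.card F = α * β ^ Fintype.card F) :
    (k + m = a + b ∧ k' + m' = a' + b') ∧
      k * m - c * k' * m' = a * b - c * a' * b' ∧ k' * m - k * m' = a' * b - a * b' := by
  rw [pow_card_of_hasCoord hq hc hs hβ, pow_card_of_hasCoord hq hc hs hμ] at hmul
  unfold hasCoord at hα hβ hκ hμ
  refine ⟨hasCoord_inj hc hs (α := κ + μ) ?_ ?_, hasCoord_inj hc hs
    (α := κ * (algebraMap F E m - algebraMap F E m' * s)) ?_ ?_⟩
  · rw [hκ, hμ]; simp only [hasCoord, map_add]; ring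
  · rw [hadd, hα, hβ]; simp only [hasCoord, map_add]; ring
  · rw [hκ]; simp only [hasCoord, map_sub, map_mul, ← hs]; ring
  · rw [hmul, hα]; simp only [hasCoord, map_sub, map_mul, ← hs]; ring

theorem swap_identities [Fintype F] {α β κ μ : E} (hα : α ^ Fintype.card F ^ 2 = α)
    (hβ : β ^ Fintype.card F ^ 2 = β) (h0 : α + β ≠ 0)
    (hμ : μ * (α + β) ^ Fintype.card F = α ^ Fintype.card F * (α + β))
    (hκ : κ * (α + β) ^ Fintype.card F = β ^ Fintype.card F * (α + β)) :
    κ + μ = α + β ∧ κ * μ ^ Fintype.card F = α * β ^ Fintype.card F ∧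
      κ ^ (Fintype.card F + 1) = β ^ (Fintype.card F + 1) ∧
      μ ^ (Fintype.card F + 1) = α ^ (Fintype.card F + 1) := by
  rw [sq, pow_mul] at hα hβ
  have h0' : (α + β) ^ Fintype.card F ≠ 0 := pow_ne_zero _ h0
  have hσ : ((α + β) ^ Fintype.card F) ^ Fintype.card F = α + β := by
    rw [pow_card_add, pow_card_add, hα, hβ]
  have hμ' : μ ^ Fintype.card F * (α + β) = α * (α + β) ^ Fintype.card F := by
    have := congrArg (· ^ Fintype.card F) hμ
    simpa only [mul_pow, hσ, hα] using this
  have hκ' : κ ^ Fintype.card F * (α + β) = β * (α + β) ^ Fintype.card F := by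
    have := congrArg (· ^ Fintype.card F) hκ
    simpa only [mul_pow, hσ, hβ] using this
  have h00 := mul_ne_zero h0' h0
  refine ⟨mul_right_cancel₀ h0' ?_, mul_right_cancel₀ h00 ?_, mul_right_cancel₀ h00 ?_,
    mul_right_cancel₀ h00 ?_⟩
  · rw [add_mul, hκ, hμ, ← add_mul, add_comm (β ^ _), ← pow_card_add, mul_comm]
  · linear_combination μ ^ Fintype.card F * (α + β) * hκ +
      β ^ Fintype.card F * (α + β) * hμ'
  · rw [pow_succ, pow_succ]
    linear_combination κ * (α + β) ^ Fintype.card F * hκ' +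
      β * (α + β) ^ Fintype.card F * hκ
  · rw [pow_succ, pow_succ]
    linear_combination μ * (α + β) ^ Fintype.card F * hμ' +
      α * (α + β) ^ Fintype.card F * hμ

end QuadraticExtension

section DiscreteLog

variable {E : Type*} [Field E] {δ : E} {n : ℕ}

theorem pow_val_natCast (h : δ ^ n = 1) (m : ℕ) : δ ^ (m : ZMod n).val = δ ^ m := by
  rw [ZMod.val_natCast, ← pow_eq_pow_mod m h]

theorem pow_val_add [NeZero n] (h : δ ^ n = 1) (i j : ZMod n) :
    δ ^ (i + j).val = δ ^ i.val * δ ^ j.val := by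
  rw [ZMod.val_add, ← pow_eq_pow_mod _ h, pow_add]

theorem pow_val_mul_natCast [NeZero n] (h : δ ^ n = 1) (i : ZMod n) (m : ℕ) :
    δ ^ (i * (m : ZMod n)).val = (δ ^ i.val) ^ m := by
  rw [← pow_mul, ← pow_val_natCast h (i.val * m)]
  simp

theorem pow_val_injective [NeZero n] (h : orderOf δ = n) :
    Function.Injective fun i : ZMod n => δ ^ i.val := fun i j hij =>
  ZMod.val_injective n (pow_injOn_Iio_orderOf (by simp [h, ZMod.val_lt])
    (by simp [h, ZMod.val_lt]) hij)

theorem orderOf_generator (hδ : ∀ x : E, x ≠ 0 → ∃ m : ℕ, x = δ ^ m) (h2 : (-1 : E) ≠ 1) :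
    δ ≠ 0 ∧ orderOf δ = Nat.card E - 1 := by
  have h0 : δ ≠ 0 := by
    rintro rfl
    obtain ⟨m, hm⟩ := hδ (-1) (by simp)
    cases m with
    | zero => exact h2 (by simpa using hm)
    | succ m => simp at hm
  refine ⟨h0, ?_⟩
  rw [← Nat.card_units, ← orderOf_eq_card_of_forall_mem_zpowers (g := Units.mk0 δ h0),
    ← orderOf_units, Units.val_mk0]
  intro x
  obtain ⟨m, hm⟩ := hδ x x.ne_zero
  exact ⟨m, Units.ext (by simp [hm])⟩

theorem mul_pred_mem [NeZero n] {M : Set (ZMod n)} {d : ZMod n} (hM : ∀ i ∈ M, i + d ∈ M)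
    (z : ZMod n) {i : ZMod n} (hi : i ∈ M) : i + z * d ∈ M := by
  have key : ∀ m : ℕ, i + (m : ZMod n) * d ∈ M := by
    intro m
    induction m with
    | zero => simpa using hi
    | succ m ih => simpa [add_mul, add_assoc] using hM _ ih
  simpa using key z.val

end DiscreteLog

section Localized

variable {F : Type} [Field F] {S₀ : Set F} {c : F}

theorem algebraMap_OS_injective : Function.Injective (algebraMap F[X] (OS F S₀)) := by
  refine IsLocalization.injective _ (M := sden F S₀) ?_
  refine Submonoid.closure_le.2 ?_
  rintro p (rfl | ⟨τ, -, rfl⟩)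
  · exact mem_nonZeroDivisors_of_ne_zero X_ne_zero
  · exact mem_nonZeroDivisors_of_ne_zero (X_sub_C_ne_zero τ)

/-- If a product of classes `[1 + α·j]` is trivial in `Λ_S`, then the product of the quaternions
`1 + α·j` over `𝔽_q[t]` is a scalar. -/
theorem exists_scalar_of_cls_eq_one {ι : Type*} {ax ay : ι → F} {w : ι → (QAS F S₀ c)ˣ}
    (hw : ∀ i, (w i : QAS F S₀ c) = oneAddJ F S₀ c (ax i) (ay i)) (L : List ι)
    (h : (L.map fun i => clsS F S₀ c (w i)).prod = 1) :
    ∃ f : F[X], (L.map fun i => (⟨1, 0, C (ax i), C (ay i)⟩ : ℍ[F[X], C c, X])).prod =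
      ⟨f, 0, 0, 0⟩ := by
  have h1 : clsS F S₀ c (L.map w).prod = 1 := by
    rw [map_list_prod, List.map_map]
    exact h
  obtain ⟨r, hr⟩ := (QuotientGroup.eq_one_iff _).1 h1
  have h2 : ((L.map w).prod : QAS F S₀ c) = ⟨(r : OS F S₀), 0, 0, 0⟩ := by
    rw [← hr]; rfl
  set φ := quatMap (algebraMap F[X] (OS F S₀)) (a := C c) (b := X) rfl rfl with hφ
  set P := (L.map fun i => (⟨1, 0, C (ax i), C (ay i)⟩ : ℍ[F[X], C c, X])).prod with hP
  have h3 : φ P = ((L.map w).prod : QAS F S₀ c) := by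
    rw [hP, map_list_prod, ← Units.coeHom_apply, map_list_prod, List.map_map, List.map_map]
    congr 2
    funext i
    simp only [Function.comp_apply, Units.coeHom_apply, hw]
    ext <;> simp [hφ, quatMap, oneAddJ, toOS]
  rw [h2] at h3
  refine ⟨P.re, ?_⟩
  have hI := congrArg QuaternionAlgebra.imI h3
  have hJ := congrArg QuaternionAlgebra.imJ h3
  have hK := congrArg QuaternionAlgebra.imK h3
  refine QuaternionAlgebra.ext rfl ?_ ?_ ?_ <;> refine algebraMap_OS_injective (S₀ := S₀) ?_
  · rw [map_zero]; exact hI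
  · rw [map_zero]; exact hJ
  · rw [map_zero]; exact hK

theorem oneAddJ_mul_eq {a a' b b' k k' m m' : F}
    (hadd : k + m = a + b ∧ k' + m' = a' + b')
    (h₁ : k * m - c * k' * m' = a * b - c * a' * b') (h₂ : k' * m - k * m' = a' * b - a * b') :
    oneAddJ F S₀ c a a' * oneAddJ F S₀ c b b' = oneAddJ F S₀ c k k' * oneAddJ F S₀ c m m' := by
  have e₁ := congrArg (toOS F S₀) h₁
  have e₂ := congrArg (toOS F S₀) h₂
  have e₃ := congrArg (toOS F S₀) hadd.1
  have e₄ := congrArg (toOS F S₀) hadd.2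
  have hc' : algebraMap F[X] (OS F S₀) (C c) = toOS F S₀ c := rfl
  simp only [map_sub, map_mul, map_add] at e₁ e₂ e₃ e₄
  ext
  · simp only [oneAddJ, QuaternionAlgebra.mk_mul_mk, hc']
    linear_combination -algebraMap F[X] (OS F S₀) X * e₁
  · simp only [oneAddJ, QuaternionAlgebra.mk_mul_mk, hc']
    linear_combination -algebraMap F[X] (OS F S₀) X * e₂
  · simp only [oneAddJ, QuaternionAlgebra.mk_mul_mk, hc']
    linear_combination -e₃
  · simp only [oneAddJ, QuaternionAlgebra.mk_mul_mk, hc']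
    linear_combination -e₄

theorem cls_mul_eq_one {a a' τ : F} (hτ : τ ∈ S₀) (h : τ * (a ^ 2 - c * a' ^ 2) = 1)
    {u v : (QAS F S₀ c)ˣ} (hu : (u : QAS F S₀ c) = oneAddJ F S₀ c (-a) (-a'))
    (hv : (v : QAS F S₀ c) = oneAddJ F S₀ c a a') : clsS F S₀ c u * clsS F S₀ c v = 1 := by
  set ν := a ^ 2 - c * a' ^ 2 with hν
  have hν0 : ν ≠ 0 := right_ne_zero_of_mul_eq_one h
  have hu' : IsUnit (algebraMap F[X] (OS F S₀) (C (-ν) * (X - C τ))) := by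
    rw [map_mul]
    refine IsUnit.mul ?_ ?_
    · exact (isUnit_C.2 (neg_ne_zero.2 hν0).isUnit).map _
    · exact IsLocalization.map_units (OS F S₀)
        (⟨_, Submonoid.subset_closure (Or.inr ⟨τ, hτ, rfl⟩)⟩ : sden F S₀)
  rw [← map_mul]
  refine (QuotientGroup.eq_one_iff _).2 ⟨hu'.unit, ?_⟩
  ext1
  have hval : algebraMap F[X] (OS F S₀) (C (-ν) * (X - C τ)) =
      1 - algebraMap F[X] (OS F S₀) X * (toOS F S₀ a ^ 2 - toOS F S₀ c * toOS F S₀ a' ^ 2) := by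
    rw [← map_pow, ← map_pow, ← map_mul, ← map_sub, ← hν]
    change _ = 1 - algebraMap F[X] (OS F S₀) X * algebraMap F[X] (OS F S₀) (C ν)
    rw [← map_mul, ← map_one (algebraMap F[X] (OS F S₀)), ← map_sub, ← C_1, ← h]
    simp only [C_mul, C_neg]
    congr 1
    ring
  have hc' : algebraMap F[X] (OS F S₀) (C c) = toOS F S₀ c := rfl
  rw [Units.val_mul, hu, hv]
  change (⟨algebraMap F[X] (OS F S₀) (C (-ν) * (X - C τ)), 0, 0, 0⟩ : QAS F S₀ c) = _
  rw [hval]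
  ext <;> simp only [oneAddJ, QuaternionAlgebra.mk_mul_mk, hc', map_neg] <;> ring

end Localized

set_option maxHeartbeats 1600000 in
/-- The concrete model `Γ_{M,δ}` is isomorphic to `Γ_S`,
via `a_i ↦ [1 + δ^i·j]`. -/
theorem gammaS_concrete_model
    (F : Type) [Field F] [Fintype F] (hq : Odd (Fintype.card F))
    (c : F) (hc : ¬IsSquare c)
    (E : Type) [Field E] [Algebra F E] (s : E)
    (hs : s ^ 2 = algebraMap F E c)
    (hspan : ∀ α : E, ∃ x y : F, hasCoord F E s α x y)
    -- δ, a generator of the multiplicative group of `𝔽_{q²}`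
    (δ : E) (hδ : ∀ x : E, x ≠ 0 → ∃ m : ℕ, x = δ ^ m)
    (n : ℕ) (hn : n = Fintype.card F ^ 2 - 1)
    -- M, a union of cosets of `(q-1)ℤ/(q²-1)ℤ`
    (M : Set (ZMod n)) (hM : ∀ i ∈ M, i + ((Fintype.card F : ZMod n) - 1) ∈ M)
    -- the discrete logarithms `x_{i,j}`: `δ^{x_{i,j}} = 1 + δ^{j-i}`
    (xf : ZMod n → ZMod n → ZMod n)
    (hxf : ∀ i j : ZMod n,
      (i - j) ∉ AddSubgroup.zmultiples ((Fintype.card F : ZMod n) - 1) →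
      δ ^ (xf i j).val = 1 + δ ^ (j - i).val)
    -- `k(i,j) = j - y_{i,j}(q-1)` with `y_{i,j} = x_{i,j} + i - j`, and `l(i,j) = i - x_{i,j}(q-1)`
    (kf lf : ZMod n → ZMod n → ZMod n)
    (hkf : ∀ i j : ZMod n, kf i j = j - (xf i j + i - j) * ((Fintype.card F : ZMod n) - 1))
    (hlf : ∀ i j : ZMod n, lf i j = i - xf i j * ((Fintype.card F : ZMod n) - 1))
    -- the units `1 + δ^i·j` for `i ∈ M`, with coordinates `δ^i = ax i + (ay i)·√c`
    (ax ay : {x : ZMod n // x ∈ M} → F)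
    (haxy : ∀ i : {x : ZMod n // x ∈ M}, hasCoord F E s (δ ^ (i : ZMod n).val) (ax i) (ay i))
    (aw : {x : ZMod n // x ∈ M} → (QAS F (SofM F E δ n M) c)ˣ)
    (haw : ∀ i, (aw i : QAS F (SofM F E δ n M) c) = oneAddJ F (SofM F E δ n M) c (ax i) (ay i)) :
    ∃ iso : PresentedGroup (relsGM (Fintype.card F) n M kf lf) ≃*
        GammaS F E s (SofM F E δ n M) c,
      ∀ i : {x : ZMod n // x ∈ M},
        ((iso (PresentedGroup.of i) : GammaS F E s (SofM F E δ n M) c) :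
          LambdaS F (SofM F E δ n M) c) = clsS F (SofM F E δ n M) c (aw i) := by
  set q := Fintype.card F with hqdef
  have hq2 : 2 < q := by
    have := Fintype.one_lt_card (α := F)
    obtain ⟨k, hk⟩ := hq
    omega
  have hcardE : Nat.card E = q ^ 2 := card_eq_sq hc hs hspan
  have hEfin : Finite E := Nat.finite_of_card_ne_zero (by rw [hcardE]; positivity)
  have hneg : (-1 : E) ≠ 1 := by
    rw [← map_one (algebraMap F E), ← map_neg, (algebraMap F E).injective.ne_iff]
    refine Ring.neg_one_ne_one_of_char_ne_two fun h2 => ?_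
    have := FiniteField.even_card_iff_char_two.1 h2
    obtain ⟨k, hk⟩ := hq
    omega
  obtain ⟨hδ0, hord⟩ := orderOf_generator hδ hneg
  rw [hcardE, ← hn] at hord
  have hq1 : q ^ 2 - 1 = (q - 1) * (q + 1) := by
    obtain ⟨k, hk⟩ : ∃ k, q = k + 1 := ⟨q - 1, by omega⟩
    rw [hk]
    simp only [Nat.add_sub_cancel]
    rw [Nat.sub_eq_iff_eq_add (Nat.one_le_pow _ _ (by omega))]
    ring
  have hnq : n = (q - 1) * (q + 1) := hn.trans hq1
  have hnpos : 0 < n := hnq ▸ Nat.mul_pos (by omega) (by omega)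
  have : NeZero n := ⟨hnpos.ne'⟩
  have hδn : δ ^ n = 1 := hord ▸ pow_orderOf_eq_one δ
  have hinj := pow_val_injective hord
  have hcast : (q : ZMod n) - 1 = ((q - 1 : ℕ) : ZMod n) := by
    rw [Nat.cast_sub (by omega), Nat.cast_one]
  have hfrob (α : E) : α ^ q ^ 2 = α := by
    have := Fintype.ofFinite E
    rw [← hcardE, Nat.card_eq_fintype_card, FiniteField.pow_card]
  have he0 (i : ZMod n) : δ ^ i.val ≠ 0 := pow_ne_zero _ hδ0
  -- the opposite letter
  have hhalf : (n / 2 : ℕ) = (q - 1) * ((q + 1) / 2) := by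
    obtain ⟨k, hk⟩ := hq
    rw [hnq, Nat.mul_div_assoc _ ⟨k + 1, by omega⟩]
  have hhalf' (i : ZMod n) : δ ^ (i + ((n / 2 : ℕ) : ZMod n)).val = -δ ^ i.val := by
    have h2 : 2 * (n / 2) = n := by
      obtain ⟨k, hk⟩ := hq
      have : (q + 1) / 2 = k + 1 := by omega
      rw [hhalf, this, hnq, hk]; ring
    have hsq : (δ ^ (n / 2)) ^ 2 = 1 := by rw [← pow_mul, mul_comm, h2, hδn]
    have hne : δ ^ (n / 2) ≠ 1 := fun h => by
      have := Nat.le_of_dvd (by omega) (orderOf_dvd_of_pow_eq_one h)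
      omega
    rw [pow_val_add hδn, pow_val_natCast hδn, (eq_or_eq_neg_of_sq_eq_sq _ _ (hsq.trans (one_pow 2).symm)).resolve_left hne]
    ring
  have hhalfM (i : ZMod n) (hi : i ∈ M) : i + ((n / 2 : ℕ) : ZMod n) ∈ M := by
    rw [hhalf, Nat.cast_mul, ← hcast, mul_comm]
    exact mul_pred_mem hM _ hi
  let op : {x : ZMod n // x ∈ M} → {x : ZMod n // x ∈ M} := fun i => ⟨_, hhalfM i i.2⟩
  -- norms
  let ν : {x : ZMod n // x ∈ M} → F := fun i => ax i ^ 2 - c * ay i ^ 2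
  have hν (i : {x : ZMod n // x ∈ M}) : (δ ^ (i : ZMod n).val) ^ (q + 1) = algebraMap F E (ν i) :=
    pow_card_succ_of_hasCoord hq hc hs (haxy i)
  have hν0 (i) : ν i ≠ 0 := fun h => by
    have := hν i
    rw [h, map_zero] at this
    exact pow_ne_zero _ (he0 _) this
  have hνS (i) : (ν i)⁻¹ ∈ SofM F E δ n M :=
    ⟨i, by rw [map_inv₀, ← hν, inv_pow, ← pow_mul, ← pow_mul, mul_comm]⟩
  have hνne {i j} (h : ν i ≠ ν j) :
      (i : ZMod n) - (j : ZMod n) ∉ AddSubgroup.zmultiples ((q : ZMod n) - 1) := by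
    rintro ⟨m, hm⟩
    refine h ((algebraMap F E).injective ?_)
    rw [← hν, ← hν, ← pow_val_mul_natCast hδn, ← pow_val_mul_natCast hδn]
    congr 2
    have hz : ((q : ZMod n) - 1) * ((q + 1 : ℕ) : ZMod n) = 0 := by
      rw [hcast, ← Nat.cast_mul, ← hnq, ZMod.natCast_self]
    simp only [zsmul_eq_mul] at hm
    linear_combination -((q + 1 : ℕ) : ZMod n) * hm + (m : ZMod n) * hz
  have hsum (i j : ZMod n)
      (hij : i - j ∉ AddSubgroup.zmultiples ((q : ZMod n) - 1)) :
      δ ^ (kf i j).val + δ ^ (lf i j).val = δ ^ i.val + δ ^ j.val ∧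
      δ ^ (kf i j).val * (δ ^ (lf i j).val) ^ q = δ ^ i.val * (δ ^ j.val) ^ q ∧
      (δ ^ (kf i j).val) ^ (q + 1) = (δ ^ j.val) ^ (q + 1) ∧
      (δ ^ (lf i j).val) ^ (q + 1) = (δ ^ i.val) ^ (q + 1) := by
    have hX : δ ^ (xf i j).val * δ ^ i.val = δ ^ i.val + δ ^ j.val := by
      rw [hxf i j hij, add_mul, ← pow_val_add hδn, one_mul, sub_add_cancel]
    have hY : δ ^ (xf i j + i - j).val * δ ^ j.val = δ ^ i.val + δ ^ j.val := by
      rw [← hX, ← pow_val_add hδn, ← pow_val_add hδn, sub_add_cancel]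
    have hl : δ ^ (lf i j).val * (δ ^ (xf i j).val) ^ q = δ ^ i.val * δ ^ (xf i j).val := by
      rw [← pow_val_mul_natCast hδn, ← pow_val_add hδn, ← pow_val_add hδn, hlf]
      congr 2; ring
    have hk : δ ^ (kf i j).val * (δ ^ (xf i j + i - j).val) ^ q =
        δ ^ j.val * δ ^ (xf i j + i - j).val := by
      rw [← pow_val_mul_natCast hδn, ← pow_val_add hδn, ← pow_val_add hδn, hkf]
      congr 2; ring
    have h0 : δ ^ i.val + δ ^ j.val ≠ 0 := hX ▸ mul_ne_zero (he0 _) (he0 _)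
    refine swap_identities (hfrob _) (hfrob _) h0 ?_ ?_
    · rw [← hX, mul_pow, ← mul_assoc, hl]
      ring
    · rw [← hY, mul_pow, ← mul_assoc, hk]
      ring
  have hkM {i j : ZMod n} (hj : j ∈ M) : kf i j ∈ M := by
    rw [hkf, sub_eq_add_neg, ← neg_mul]
    exact mul_pred_mem hM _ hj
  have hlM {i j : ZMod n} (hi : i ∈ M) : lf i j ∈ M := by
    rw [hlf, sub_eq_add_neg, ← neg_mul]
    exact mul_pred_mem hM _ hi
  -- the homomorphism
  have hmem (i) : clsS F (SofM F E δ n M) c (aw i) ∈ GammaS F E s (SofM F E δ n M) c := by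
    refine Subgroup.subset_closure (Set.mem_iUnion₂.2 ⟨(ν i)⁻¹, hνS i, ?_⟩)
    exact ⟨_, ax i, ay i, aw i, haxy i, by rw [inv_inv]; exact hν i, haw i, rfl⟩
  let f : {x : ZMod n // x ∈ M} → GammaS F E s (SofM F E δ n M) c := fun i => ⟨_, hmem i⟩
  have hopp {i j : {x : ZMod n // x ∈ M}}
      (h : (j : ZMod n) = (i : ZMod n) + ((n / 2 : ℕ) : ZMod n)) :
      ax j = -ax i ∧ ay j = -ay i := by
    refine hasCoord_inj hc hs (haxy j) ?_
    have := haxy i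
    unfold hasCoord at this ⊢
    rw [h, hhalf', this, map_neg, map_neg]
    ring
  have hrels : ∀ r ∈ relsGM q n M kf lf, FreeGroup.lift f r = 1 := by
    rintro r (⟨i, j, hij, rfl⟩ | ⟨i, j, k, l, hij, hk, hl, rfl⟩)
    · obtain ⟨hx, hy⟩ := hopp hij
      simp only [map_mul, FreeGroup.lift_apply_of]
      refine Subtype.ext (cls_mul_eq_one (hνS i) (inv_mul_cancel₀ (hν0 i)) ?_ (haw i))
      rw [haw, hx, hy]
    · simp only [map_mul, map_inv, FreeGroup.lift_apply_of]
      rw [mul_inv_eq_one]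
      obtain ⟨hadd, hmul, -, -⟩ := hsum i j hij
      rw [← hk, ← hl] at hadd hmul
      obtain ⟨h₁, h₂, h₃⟩ := coord_relations hq hc hs (haxy i) (haxy j) (haxy k) (haxy l) hadd hmul
      refine Subtype.ext ?_
      change clsS F (SofM F E δ n M) c (aw i) * clsS F (SofM F E δ n M) c (aw j) =
        clsS F (SofM F E δ n M) c (aw k) * clsS F (SofM F E δ n M) c (aw l)
      rw [← map_mul, ← map_mul]
      congr 1
      ext1
      simp only [Units.val_mul, haw]
      exact oneAddJ_mul_eq h₁ h₂ h₃
  let ψ := PresentedGroup.toGroup hrels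
  have hψ (i) : ((ψ (PresentedGroup.of i) : GammaS F E s (SofM F E δ n M) c) :
      LambdaS F (SofM F E δ n M) c) = clsS F (SofM F E δ n M) c (aw i) := by
    simp [ψ, f]
  have hopG (i j : {x : ZMod n // x ∈ M})
      (h : (j : ZMod n) = (i : ZMod n) + ((n / 2 : ℕ) : ZMod n)) :
      (PresentedGroup.of j * PresentedGroup.of i : PresentedGroup (relsGM q n M kf lf)) = 1 :=
    PresentedGroup.one_of_mem (Or.inl ⟨i, j, h, rfl⟩)
  have hinjψ : Function.Injective ψ := by
    rw [injective_iff_map_eq_one]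
    intro x hx
    by_contra hx1
    obtain ⟨a, L₁, L₂, hxL, hL₁, hL₂, hch⟩ := exists_reduced_block
      (PresentedGroup.of : _ → PresentedGroup (relsGM q n M kf lf)) ν op
      (fun i => hopG i (op i) rfl) (PresentedGroup.closure_range_of _) (fun i j hij => by
        refine ⟨⟨_, hkM (i := i) j.2⟩, ⟨_, hlM (j := j) i.2⟩, ?_, ?_, ?_⟩
        · exact PresentedGroup.mk_eq_mk_of_mul_inv_mem (Or.inr ⟨i, j, _, _, hνne hij, rfl, rfl, rfl⟩)
        · refine (algebraMap F E).injective ?_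
          rw [← hν, ← hν]
          exact (hsum i j (hνne hij)).2.2.1
        · refine (algebraMap F E).injective ?_
          rw [← hν, ← hν]
          exact (hsum i j (hνne hij)).2.2.2) x hx1
    have hcls : (((a :: L₁) ++ L₂).map fun i => clsS F (SofM F E δ n M) c (aw i)).prod = 1 := by
      have h1 := congrArg (Subgroup.subtype _) hx
      rw [hxL, map_mul, map_mul, map_list_prod, map_list_prod, map_list_prod, map_list_prod,
        map_one] at h1
      rw [List.map_append, List.prod_append, ← h1]
      simp only [List.map_map]
      congr 3 <;> funext i <;> exact (hψ i).symm
    obtain ⟨p, hp⟩ := exists_scalar_of_cls_eq_one haw _ hcls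
    refine not_scalar hc ax ay a L₁ L₂ (hν0 a) hL₁ hL₂ (hch.imp ?_) p hp
    rintro b d hbd ⟨h1, h2⟩
    refine hbd (hopG d b (hinj ?_))
    have hb := haxy b
    have hd := haxy d
    unfold hasCoord at hb hd
    simp only [hhalf', hb, hd, h1, h2, map_neg]
    ring
  have hsurj : Function.Surjective ψ := by
    have hle : GammaS F E s (SofM F E δ n M) c ≤ ((Subgroup.subtype _).comp ψ).range := by
      refine (Subgroup.closure_le _).2 (Set.iUnion₂_subset ?_)
      rintro τ ⟨i, hi⟩ z ⟨α, x, y, w, hα, hN, hw, rfl⟩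
      rw [map_inv₀, hi, inv_pow, inv_inv, ← pow_mul, mul_comm, pow_mul] at hN
      have hα0 : α ≠ 0 := by
        rintro rfl
        rw [zero_pow (by omega)] at hN
        exact pow_ne_zero _ (he0 _) hN.symm
      obtain ⟨m, rfl⟩ := hδ α hα0
      have hm : (m : ZMod n) ∈ M := by
        rw [← pow_val_natCast hδn m, ← pow_val_mul_natCast hδn, ← pow_val_mul_natCast hδn] at hN
        have h0 : ((m : ZMod n) - i) * ((q + 1 : ℕ) : ZMod n) = 0 := by
          rw [sub_mul, hinj hN, sub_self]
        set z := (m : ZMod n) - i with hz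
        rw [← ZMod.natCast_zmod_val z, ← Nat.cast_mul, ZMod.natCast_eq_zero_iff] at h0
        obtain ⟨t, ht⟩ := Nat.dvd_of_mul_dvd_mul_right (by omega) (hnq.symm.dvd.trans h0)
        have hz' : z = (t : ZMod n) * ((q : ZMod n) - 1) := by
          rw [← ZMod.natCast_zmod_val z, ht, Nat.cast_mul, hcast, mul_comm]
        rw [show (m : ZMod n) = i + (t : ZMod n) * ((q : ZMod n) - 1) by rw [← hz', hz]; ring]
        exact mul_pred_mem hM _ i.2
      refine ⟨PresentedGroup.of ⟨m, hm⟩, (hψ _).trans ?_⟩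
      congr 1
      ext1
      have hcoord := haxy ⟨m, hm⟩
      rw [pow_val_natCast hδn] at hcoord
      obtain ⟨h1, h2⟩ := hasCoord_inj hc hs hα hcoord
      rw [haw, hw, h1, h2]
    rintro ⟨y, hy⟩
    obtain ⟨x, hx⟩ := hle hy
    exact ⟨x, Subtype.ext hx⟩
  exact ⟨MulEquiv.ofBijective ψ ⟨hinjψ, hsurj⟩, hψ⟩
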